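/- arXiv:math/0609230 — 8 statements merged into one kernel-verified Lean document; each statement's English description precedes it below -/
import Mathlib

section
/- Let m, n ≥ 2 be integers, let S be an (m−1)×(n−1) integer matrix, let r : {0,…,n−1} → ℤ and c : {0,…,m−1} → ℤ with r(0) = c(0). Then there exists a unique m×n integer matrix A such that A_{0,j} = r(j) for all j, A_{i,0} = c(i) for all i, and Σ₂₂(A) = S. In other words, a matrix is uniquely determined by its zero row, its zero column, and its matrix of 2×2 window sums. -/
/-- The matrix of sums over all 2×2 windows of an integer matrix. -/
def sum22 {m n : ℕ} (A : Matrix (Fin m) (Fin n) ℤ) :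
    Matrix (Fin (m - 1)) (Fin (n - 1)) ℤ :=
  fun i j =>
    A ⟨i, by omega⟩ ⟨j, by omega⟩ + A ⟨i, by omega⟩ ⟨j + 1, by omega⟩ +
    A ⟨i + 1, by omega⟩ ⟨j, by omega⟩ + A ⟨i + 1, by omega⟩ ⟨j + 1, by omega⟩

/-- The array on `ℕ × ℕ` with zero row `r`, zero column `c` (away from the corner) and
2×2 window sums `s`. -/
def windowFill (r c : ℕ → ℤ) (s : ℕ → ℕ → ℤ) : ℕ → ℕ → ℤ
  | 0, j => r j
  | i + 1, 0 => c (i + 1)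
  | i + 1, j + 1 =>
    s i j - windowFill r c s i j - windowFill r c s i (j + 1) - windowFill r c s (i + 1) j

/-- Two matrices with the same zero row, zero column and 2×2 window sums are equal. -/
theorem eq_of_row_col_sum22 {m n : ℕ} (hm : 0 < m) (hn : 0 < n)
    {A B : Matrix (Fin m) (Fin n) ℤ}
    (hrow : ∀ j, A ⟨0, hm⟩ j = B ⟨0, hm⟩ j) (hcol : ∀ i, A i ⟨0, hn⟩ = B i ⟨0, hn⟩)
    (hsum : sum22 A = sum22 B) : A = B := by
  have key : ∀ (i : ℕ) (hi : i < m) (j : ℕ) (hj : j < n), A ⟨i, hi⟩ ⟨j, hj⟩ = B ⟨i, hi⟩ ⟨j, hj⟩ := by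
    intro i
    induction i with
    | zero => exact fun _ j hj => hrow ⟨j, hj⟩
    | succ i ihi =>
      intro hi j
      induction j with
      | zero => exact fun _ => hcol ⟨i + 1, hi⟩
      | succ j ihj =>
        intro hj
        have h := congrFun (congrFun hsum ⟨i, by omega⟩) ⟨j, by omega⟩
        simp only [sum22] at h
        linarith [ihi (by omega) j (by omega), ihi (by omega) (j + 1) hj, ihj (by omega)]
  ext i j
  exact key i i.2 j j.2

/-- A matrix is uniquely determined by its zero row, its zero column, and its
matrix of 2×2 window sums. -/
theorem exists_unique_of_row_col_sum22
    (m n : ℕ) (hm : 2 ≤ m) (hn : 2 ≤ n)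
    (S : Matrix (Fin (m - 1)) (Fin (n - 1)) ℤ)
    (r : Fin n → ℤ) (c : Fin m → ℤ)
    (hrc : r ⟨0, by omega⟩ = c ⟨0, by omega⟩) :
    ∃! A : Matrix (Fin m) (Fin n) ℤ,
      (∀ j : Fin n, A ⟨0, by omega⟩ j = r j) ∧
      (∀ i : Fin m, A i ⟨0, by omega⟩ = c i) ∧
      sum22 A = S := by
  have existence : ∃ A : Matrix (Fin m) (Fin n) ℤ,
      (∀ j : Fin n, A ⟨0, by omega⟩ j = r j) ∧
      (∀ i : Fin m, A i ⟨0, by omega⟩ = c i) ∧ sum22 A = S := by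
    refine ⟨fun i j => windowFill (fun j => if h : j < n then r ⟨j, h⟩ else 0)
      (fun i => if h : i < m then c ⟨i, h⟩ else 0)
      (fun i j => if h : i < m - 1 ∧ j < n - 1 then S ⟨i, h.1⟩ ⟨j, h.2⟩ else 0) i j, ?_, ?_, ?_⟩
    · intro j
      simp [windowFill]
    · rintro ⟨_ | i, hi⟩
      · simpa [windowFill, show 0 < n by omega] using hrc
      · simp [windowFill, hi]
    · ext i j
      simp only [sum22, windowFill, i.2, j.2, and_self, dite_true, Fin.eta]
      ring
  obtain ⟨A, hrow, hcol, hsum⟩ := existence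
  refine ⟨A, ⟨hrow, hcol, hsum⟩, fun B ⟨hBrow, hBcol, hBsum⟩ => ?_⟩
  exact eq_of_row_col_sum22 (by omega) (by omega) (fun j => (hBrow j).trans (hrow j).symm)
    (fun i => (hBcol i).trans (hcol i).symm) (hBsum.trans hsum.symm)
end

section
/- Let A be an m×n integer matrix (m, n ≥ 2) with Σ₂₂(A) = 0 (all 2×2 window sums are zero). Then for all indices 0 ≤ i ≤ m−1 and 0 ≤ j ≤ n−1, A_{i,j} = (−1)^i · A_{0,j} + (−1)^j · A_{i,0} − (−1)^{i+j} · A_{0,0}. -/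
/-- If all 2×2 window sums of `A` vanish, then
`A i j = (−1)^i A 0 j + (−1)^j A i 0 − (−1)^(i+j) A 0 0`. -/
theorem entry_eq_of_sum22_eq_zero
    (m n : ℕ) (hm : 2 ≤ m) (hn : 2 ≤ n)
    (A : Matrix (Fin m) (Fin n) ℤ)
    (hA : sum22 A = 0) :
    ∀ (i : Fin m) (j : Fin n),
      A i j = (-1 : ℤ) ^ (i : ℕ) * A ⟨0, by omega⟩ j
            + (-1 : ℤ) ^ (j : ℕ) * A i ⟨0, by omega⟩
            - (-1 : ℤ) ^ ((i : ℕ) + (j : ℕ)) * A ⟨0, by omega⟩ ⟨0, by omega⟩ := by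
  have window : ∀ (i j : ℕ) (hi : i + 1 < m) (hj : j + 1 < n),
      A ⟨i, by omega⟩ ⟨j, by omega⟩ + A ⟨i, by omega⟩ ⟨j + 1, hj⟩ +
        A ⟨i + 1, hi⟩ ⟨j, by omega⟩ + A ⟨i + 1, hi⟩ ⟨j + 1, hj⟩ = 0 := fun i j hi hj =>
    congrFun (congrFun hA ⟨i, by omega⟩) ⟨j, by omega⟩
  rintro ⟨i, hi⟩ ⟨j, hj⟩
  induction i generalizing j with
  | zero => simp
  | succ i ihi =>
    induction j with
    | zero => simp
    | succ j ihj =>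
      have h₀ := ihi (by omega) j (by omega)
      have h₁ := ihi (by omega) (j + 1) hj
      have h₂ := ihj (by omega)
      have hw := window i j hi hj
      simp only [pow_add, pow_one] at h₀ h₁ h₂ ⊢
      linear_combination hw - h₀ - h₁ - h₂
end

section
/- An m×n integer matrix A (m, n ≥ 2) satisfies Σ₂₂(A) = 0 if and only if there exist x : {0,…,n−1} → ℤ, y : {0,…,m−1} → ℤ and c ∈ ℤ such that A_{i,j} = (−1)^i · x(j) + (−1)^j · y(i) + (−1)^{i+j} · c for all i, j. -/
theorem add_adjacent_of_sum22_eq_zero {m n : ℕ} {A : Matrix (Fin m) (Fin n) ℤ}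
    (h : sum22 A = 0) (i j : ℕ) (hi : i < m) (hj : j + 1 < n) :
    A ⟨i, hi⟩ ⟨j, by omega⟩ + A ⟨i, hi⟩ ⟨j + 1, hj⟩ =
      (-1) ^ i * (A ⟨0, by omega⟩ ⟨j, by omega⟩ + A ⟨0, by omega⟩ ⟨j + 1, hj⟩) := by
  induction i with
  | zero => simp
  | succ i ih =>
    have hw := congrFun (congrFun h ⟨i, by omega⟩) ⟨j, by omega⟩
    simp only [sum22, Matrix.zero_apply] at hw
    rw [pow_succ]
    linear_combination hw - ih (by omega)

theorem apply_eq_of_sum22_eq_zero {m n : ℕ} {A : Matrix (Fin m) (Fin n) ℤ}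
    (h : sum22 A = 0) (i j : ℕ) (hi : i < m) (hj : j < n) :
    A ⟨i, hi⟩ ⟨j, hj⟩ =
      (-1) ^ i * A ⟨0, by omega⟩ ⟨j, hj⟩ + (-1) ^ j * A ⟨i, hi⟩ ⟨0, by omega⟩ +
        (-1) ^ (i + j) * -A ⟨0, by omega⟩ ⟨0, by omega⟩ := by
  induction j with
  | zero => simp
  | succ j ih =>
    have hr := add_adjacent_of_sum22_eq_zero h i j hi hj
    rw [← add_assoc, pow_succ, pow_succ]
    linear_combination hr - ih (by omega)

/-- All 2×2 window sums of `A` vanish iff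
`A i j = (−1)^i x j + (−1)^j y i + (−1)^(i+j) c` for some `x`, `y`, `c`. -/
theorem sum22_eq_zero_iff
    (m n : ℕ) (hm : 2 ≤ m) (hn : 2 ≤ n)
    (A : Matrix (Fin m) (Fin n) ℤ) :
    sum22 A = 0 ↔
      ∃ (x : Fin n → ℤ) (y : Fin m → ℤ) (c : ℤ),
        ∀ (i : Fin m) (j : Fin n),
          A i j = (-1 : ℤ) ^ (i : ℕ) * x j
                + (-1 : ℤ) ^ (j : ℕ) * y i
                + (-1 : ℤ) ^ ((i : ℕ) + (j : ℕ)) * c := by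
  constructor
  · intro h
    exact ⟨fun j => A ⟨0, by omega⟩ j, fun i => A i ⟨0, by omega⟩,
      -A ⟨0, by omega⟩ ⟨0, by omega⟩,
      fun i j => apply_eq_of_sum22_eq_zero h i j i.isLt j.isLt⟩
  · rintro ⟨x, y, c, h⟩
    ext i j
    simp only [sum22, h, Matrix.zero_apply]
    ring
end

section
/- Let A and A′ be m×n integer matrices (m, n ≥ 2) with Σ₂₂(A) = Σ₂₂(A′) and A_{0,0} = A′_{0,0}. Then for all indices i, j, A_{i,j} − A′_{i,j} = (−1)^i · (A_{0,j} − A′_{0,j}) + (−1)^j · (A_{i,0} − A′_{i,0}). Equivalently, every matrix A with given 2×2 window sums S and given corner entry A_{0,0} has the form A_{i,j} = (−1)^i x_j + (−1)^j y_i + b_{i,j}, where x_j, y_i are the remaining entries of the zero row and zero column of A and the constants b_{i,j} depend only on A_{0,0} and S. -/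
/-- Two matrices with the same 2×2 window sums and the same corner entry differ
entrywise by `(−1)^i (A 0 j − A' 0 j) + (−1)^j (A i 0 − A' i 0)`. -/
theorem sub_entry_of_sum22_eq
    (m n : ℕ) (hm : 2 ≤ m) (hn : 2 ≤ n)
    (A A' : Matrix (Fin m) (Fin n) ℤ)
    (hS : sum22 A = sum22 A')
    (h00 : A ⟨0, by omega⟩ ⟨0, by omega⟩ = A' ⟨0, by omega⟩ ⟨0, by omega⟩) :
    ∀ (i : Fin m) (j : Fin n),
      A i j - A' i j
        = (-1 : ℤ) ^ (i : ℕ) * (A ⟨0, by omega⟩ j - A' ⟨0, by omega⟩ j)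
        + (-1 : ℤ) ^ (j : ℕ) * (A i ⟨0, by omega⟩ - A' i ⟨0, by omega⟩) := by
  have key : ∀ (i j : ℕ) (hi : i < m) (hj : j < n),
      A ⟨i, hi⟩ ⟨j, hj⟩ - A' ⟨i, hi⟩ ⟨j, hj⟩
        = (-1 : ℤ) ^ i * (A ⟨0, by omega⟩ ⟨j, hj⟩ - A' ⟨0, by omega⟩ ⟨j, hj⟩)
        + (-1 : ℤ) ^ j * (A ⟨i, hi⟩ ⟨0, by omega⟩ - A' ⟨i, hi⟩ ⟨0, by omega⟩) := by
    intro i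
    induction i with
    | zero =>
      intro j hi hj
      rw [h00]
      ring
    | succ i ihi =>
      intro j hi
      induction j with
      | zero =>
        intro hj
        rw [h00]
        ring
      | succ j ihj =>
        intro hj
        have window := congrFun (congrFun hS ⟨i, by omega⟩) ⟨j, by omega⟩
        simp only [sum22] at window
        have h₀ := ihi j (by omega) (by omega)
        have h₁ := ihi (j + 1) (by omega) hj
        have h₂ := ihj (by omega)
        linear_combination window - h₀ - h₁ - h₂
  intro i j
  exact key i j i.isLt j.isLt
end

section
/- Let m, n ≥ 2, let U be an m×n integer matrix, let S be an (m−1)×(n−1) integer matrix, and let B be any m×n integer matrix with Σ₂₂(B) = S. Then there exists an m×n integer matrix A with 0 ≤ A_{i,j} ≤ U_{i,j} for all i, j, Σ₂₂(A) = S and A_{0,0} = B_{0,0}, if and only if there exist x : {0,…,n−1} → ℤ and y : {0,…,m−1} → ℤ with x(0) = 0, y(0) = 0, and 0 ≤ B_{i,j} + (−1)^i · x(j) + (−1)^j · y(i) ≤ U_{i,j} for all i, j. -/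
/-- A matrix with vanishing window sums is determined by its first row and first column. -/
theorem eq_of_sum22_eq_zero {m n : ℕ} (hm : 0 < m) (hn : 0 < n)
    {D : Matrix (Fin m) (Fin n) ℤ} (hD : sum22 D = 0) (i j : ℕ) (hi : i < m) (hj : j < n) :
    D ⟨i, hi⟩ ⟨j, hj⟩ = (-1) ^ i * D ⟨0, hm⟩ ⟨j, hj⟩ + (-1) ^ j * D ⟨i, hi⟩ ⟨0, hn⟩
      - (-1) ^ (i + j) * D ⟨0, hm⟩ ⟨0, hn⟩ := by
  induction i generalizing j with
  | zero => simp
  | succ i ihi =>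
    induction j with
    | zero => simp
    | succ j ihj =>
      have h := congrFun (congrFun hD ⟨i, by omega⟩) ⟨j, by omega⟩
      simp only [sum22, Matrix.zero_apply] at h
      have h₁ := ihi j (by omega) (by omega)
      have h₂ := ihi (j + 1) (by omega) hj
      have h₃ := ihj (by omega)
      simp only [pow_succ, pow_add] at h₁ h₂ h₃ ⊢
      linear_combination h - h₁ - h₂ - h₃

theorem sum22_sub {m n : ℕ} (A B : Matrix (Fin m) (Fin n) ℤ) :
    sum22 (A - B) = sum22 A - sum22 B := by
  ext i j
  simp only [sum22, Matrix.sub_apply]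
  ring

/-- Adding alternating multiples of a row vector and a column vector preserves window sums. -/
theorem sum22_add_alternating {m n : ℕ} (B : Matrix (Fin m) (Fin n) ℤ)
    (x : Fin n → ℤ) (y : Fin m → ℤ) :
    sum22 (fun i j => B i j + (-1 : ℤ) ^ (i : ℕ) * x j + (-1 : ℤ) ^ (j : ℕ) * y i) =
      sum22 B := by
  ext i j
  simp only [sum22, pow_succ]
  ring

/-- The 2×2 problem with upper constraints, prescribed sums `S` and prescribed
corner entry is solvable iff the system of inequalities
`0 ≤ B i j + (−1)^i x j + (−1)^j y i ≤ U i j` (with `x 0 = y 0 = 0`)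
has an integer solution, where `B` is any fixed matrix with `sum22 B = S`. -/
theorem upper_constraints_2x2_iff
    (m n : ℕ) (hm : 2 ≤ m) (hn : 2 ≤ n)
    (U : Matrix (Fin m) (Fin n) ℤ)
    (S : Matrix (Fin (m - 1)) (Fin (n - 1)) ℤ)
    (B : Matrix (Fin m) (Fin n) ℤ)
    (hB : sum22 B = S) :
    (∃ A : Matrix (Fin m) (Fin n) ℤ,
        (∀ (i : Fin m) (j : Fin n), 0 ≤ A i j ∧ A i j ≤ U i j) ∧
        sum22 A = S ∧
        A ⟨0, by omega⟩ ⟨0, by omega⟩ = B ⟨0, by omega⟩ ⟨0, by omega⟩) ↔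
    (∃ (x : Fin n → ℤ) (y : Fin m → ℤ),
        x ⟨0, by omega⟩ = 0 ∧ y ⟨0, by omega⟩ = 0 ∧
        ∀ (i : Fin m) (j : Fin n),
          0 ≤ B i j + (-1 : ℤ) ^ (i : ℕ) * x j + (-1 : ℤ) ^ (j : ℕ) * y i ∧
          B i j + (-1 : ℤ) ^ (i : ℕ) * x j + (-1 : ℤ) ^ (j : ℕ) * y i ≤ U i j) := by
  constructor
  · rintro ⟨A, hA, hS, h₀⟩
    have hD : sum22 (A - B) = 0 := by rw [sum22_sub, hS, hB, sub_self]
    refine ⟨fun j => (A - B) ⟨0, by omega⟩ j, fun i => (A - B) i ⟨0, by omega⟩,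
      by simp [h₀], by simp [h₀], fun i j => ?_⟩
    have h := eq_of_sum22_eq_zero (by omega) (by omega) hD i j i.2 j.2
    simp only [Matrix.sub_apply, Fin.eta, h₀, sub_self, mul_zero, sub_zero] at h ⊢
    rw [add_assoc, ← h, add_sub_cancel]
    exact hA i j
  · rintro ⟨x, y, hx, hy, h⟩
    refine ⟨fun i j => B i j + (-1 : ℤ) ^ (i : ℕ) * x j + (-1 : ℤ) ^ (j : ℕ) * y i,
      h, (sum22_add_alternating B x y).trans hB, ?_⟩
    simp [hx, hy]
end

section
/- Let C be a 2-CNF formula over a set V of Boolean variables. If for some variable v ∈ V the literal ¬v is reachable from the literal v in the implication graph of C, and the literal v is reachable from the literal ¬v, then C is unsatisfiable (no assignment σ : V → Bool satisfies C). -/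
/-- A literal over the variable set `V`: a variable together with a polarity
(`true` = the variable itself, `false` = its negation). -/
abbrev Lit (V : Type*) := V × Bool

/-- Negation of a literal. -/
def Lit.neg {V : Type*} (l : Lit V) : Lit V := (l.1, !l.2)

/-- Evaluation of a literal under an assignment. -/
def Lit.eval {V : Type*} (σ : V → Bool) (l : Lit V) : Bool :=
  if l.2 then σ l.1 else !(σ l.1)

/-- An assignment satisfies a 2-CNF formula (a finite set of two-literal
clauses) if every clause contains a true literal. -/
def Satisfies {V : Type*} (σ : V → Bool) (C : Finset (Lit V × Lit V)) : Prop :=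
  ∀ p ∈ C, Lit.eval σ p.1 = true ∨ Lit.eval σ p.2 = true

/-- The arc relation of the implication graph of a 2-CNF formula: each clause
`{l₁, l₂}` contributes the arcs `¬l₁ → l₂` and `¬l₂ → l₁`. -/
def Arc {V : Type*} (C : Finset (Lit V × Lit V)) (a b : Lit V) : Prop :=
  ∃ p ∈ C, (a = Lit.neg p.1 ∧ b = p.2) ∨ (a = Lit.neg p.2 ∧ b = p.1)

/-- Reachability in the implication graph (reflexive-transitive closure). -/
def Reach {V : Type*} (C : Finset (Lit V × Lit V)) : Lit V → Lit V → Prop :=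
  Relation.ReflTransGen (Arc C)

theorem Lit.eval_neg {V : Type*} (σ : V → Bool) (l : Lit V) :
    Lit.eval σ (Lit.neg l) = !Lit.eval σ l := by
  obtain ⟨v, b⟩ := l
  cases b <;> simp [Lit.eval, Lit.neg]

/-- Under a satisfying assignment, truth propagates along arcs. -/
theorem Satisfies.eval_of_arc {V : Type*} {σ : V → Bool} {C : Finset (Lit V × Lit V)}
    (hσ : Satisfies σ C) {a b : Lit V} (hab : Arc C a b) (ha : Lit.eval σ a = true) :
    Lit.eval σ b = true := by
  obtain ⟨p, hp, ⟨rfl, rfl⟩ | ⟨rfl, rfl⟩⟩ := hab <;>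
    have h := hσ p hp <;> simp_all [Lit.eval_neg]

/-- Under a satisfying assignment, truth propagates along paths. -/
theorem Satisfies.eval_of_reach {V : Type*} {σ : V → Bool} {C : Finset (Lit V × Lit V)}
    (hσ : Satisfies σ C) {a b : Lit V} (hab : Reach C a b) (ha : Lit.eval σ a = true) :
    Lit.eval σ b = true := by
  induction hab with
  | refl => exact ha
  | tail _ hbc ih => exact hσ.eval_of_arc hbc ih

/-- If some variable `v` and its negation are mutually reachable in the
implication graph of a 2-CNF formula `C`, then `C` is unsatisfiable. -/
theorem unsat_of_mutual_reach {V : Type*} (C : Finset (Lit V × Lit V)) (v : V)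
    (h₁ : Reach C (v, true) (v, false))
    (h₂ : Reach C (v, false) (v, true)) :
    ∀ σ : V → Bool, ¬ Satisfies σ C := by
  intro σ hσ
  have h_pos := hσ.eval_of_reach h₁
  have h_neg := hσ.eval_of_reach h₂
  cases h : σ v <;> simp [Lit.eval, h] at h_pos h_neg
end

section
/- Let m ≥ 2, n ≥ 3, let S be an (m−1)×(n−2) integer matrix, let r : {0,…,n−1} → ℤ and c⁰, c¹ : {0,…,m−1} → ℤ with c⁰(0) = r(0) and c¹(0) = r(1). Then there exists a unique m×n integer matrix A such that A_{0,j} = r(j) for all j, A_{i,0} = c⁰(i) and A_{i,1} = c¹(i) for all i, and Σ₂₃(A) = S. In other words, a matrix is uniquely determined by its zero row, its two leftmost columns, and its matrix of 2×3 window sums. -/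
/-- The matrix of sums over all 2×3 windows of an integer matrix. -/
def sum23 {m n : ℕ} (A : Matrix (Fin m) (Fin n) ℤ) :
    Matrix (Fin (m - 1)) (Fin (n - 2)) ℤ :=
  fun i j =>
    A ⟨i, by omega⟩ ⟨j, by omega⟩ + A ⟨i, by omega⟩ ⟨j + 1, by omega⟩ +
    A ⟨i, by omega⟩ ⟨j + 2, by omega⟩ +
    A ⟨i + 1, by omega⟩ ⟨j, by omega⟩ + A ⟨i + 1, by omega⟩ ⟨j + 1, by omega⟩ +
    A ⟨i + 1, by omega⟩ ⟨j + 2, by omega⟩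

/-- The array on `ℕ × ℕ` with zero row `r`, two leftmost columns `c0` and `c1`, and 2×3 window
sums `S`, filled in row by row. -/
def fillSum23 (S : ℕ → ℕ → ℤ) (r c0 c1 : ℕ → ℤ) : ℕ → ℕ → ℤ
  | 0, j => r j
  | i + 1, 0 => c0 (i + 1)
  | i + 1, 1 => c1 (i + 1)
  | i + 1, j + 2 =>
    S i j - fillSum23 S r c0 c1 i j - fillSum23 S r c0 c1 i (j + 1)
      - fillSum23 S r c0 c1 i (j + 2) - fillSum23 S r c0 c1 (i + 1) j
      - fillSum23 S r c0 c1 (i + 1) (j + 1)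

/-- Two matrices with the same 2×3 window sums that agree on the zero row and on the two
leftmost columns are equal. -/
theorem eq_of_sum23_eq {m n : ℕ} {A B : Matrix (Fin m) (Fin n) ℤ}
    (hrow : ∀ (i : Fin m) (j : Fin n), (i : ℕ) = 0 → A i j = B i j)
    (hcol : ∀ (i : Fin m) (j : Fin n), (j : ℕ) < 2 → A i j = B i j)
    (hsum : sum23 A = sum23 B) : A = B := by
  have key : ∀ (i : ℕ) (hi : i < m) (j : ℕ) (hj : j < n),
      A ⟨i, hi⟩ ⟨j, hj⟩ = B ⟨i, hi⟩ ⟨j, hj⟩ := by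
    intro i
    induction i with
    | zero => exact fun hi j hj => hrow _ _ rfl
    | succ i ihi =>
      intro hi j
      induction j using Nat.strong_induction_on with
      | h j ihj =>
        intro hj
        obtain hj2 | ⟨k, rfl⟩ : j < 2 ∨ ∃ k, j = k + 2 := by
          rcases lt_or_ge j 2 with h | h
          · exact Or.inl h
          · exact Or.inr ⟨j - 2, by omega⟩
        · exact hcol _ _ hj2
        · have h := congrFun (congrFun hsum ⟨i, by omega⟩) ⟨k, by omega⟩
          simp only [sum23] at h
          have h1 := ihi (by omega) k (by omega)
          have h2 := ihi (by omega) (k + 1) (by omega)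
          have h3 := ihi (by omega) (k + 2) hj
          have h4 := ihj k (by omega) (by omega)
          have h5 := ihj (k + 1) (by omega) (by omega)
          linarith
  ext i j
  exact key i i.isLt j j.isLt

/-- A matrix is uniquely determined by its zero row, its two leftmost columns,
and its matrix of 2×3 window sums. -/
theorem exists_unique_of_row_two_cols_sum23
    (m n : ℕ) (hm : 2 ≤ m) (hn : 3 ≤ n)
    (S : Matrix (Fin (m - 1)) (Fin (n - 2)) ℤ)
    (r : Fin n → ℤ) (c0 c1 : Fin m → ℤ)
    (hc0 : c0 ⟨0, by omega⟩ = r ⟨0, by omega⟩)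
    (hc1 : c1 ⟨0, by omega⟩ = r ⟨1, by omega⟩) :
    ∃! A : Matrix (Fin m) (Fin n) ℤ,
      (∀ j : Fin n, A ⟨0, by omega⟩ j = r j) ∧
      (∀ i : Fin m, A i ⟨0, by omega⟩ = c0 i) ∧
      (∀ i : Fin m, A i ⟨1, by omega⟩ = c1 i) ∧
      sum23 A = S := by
  refine existsUnique_of_exists_of_unique ?_ ?_
  · refine ⟨fun i j => fillSum23
      (fun i j => if h : i < m - 1 ∧ j < n - 2 then S ⟨i, h.1⟩ ⟨j, h.2⟩ else 0)
      (fun j => if h : j < n then r ⟨j, h⟩ else 0)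
      (fun i => if h : i < m then c0 ⟨i, h⟩ else 0)
      (fun i => if h : i < m then c1 ⟨i, h⟩ else 0) i j, ?_, ?_, ?_, ?_⟩
    · intro j
      simp [fillSum23]
    · rintro ⟨_ | i, hi⟩
      · simp [fillSum23, hc0, show 0 < n by omega]
      · simp [fillSum23, hi]
    · rintro ⟨_ | i, hi⟩
      · simp [fillSum23, hc1, show 1 < n by omega]
      · simp [fillSum23, hi]
    · ext i j
      simp only [sum23, fillSum23, i.isLt, j.isLt, and_self, dite_true]
      ring
  · rintro A B ⟨hAr, hA0, hA1, hAS⟩ ⟨hBr, hB0, hB1, hBS⟩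
    refine eq_of_sum23_eq ?_ ?_ (hAS.trans hBS.symm)
    · rintro ⟨_, hi⟩ j rfl
      exact (hAr j).trans (hBr j).symm
    · rintro i ⟨_ | _ | j, hj⟩ h
      · exact (hA0 i).trans (hB0 i).symm
      · exact (hA1 i).trans (hB1 i).symm
      · simp at h
end

section
/- Let A be an m×n integer matrix (m ≥ 2, n ≥ 3) with Σ₂₃(A) = 0 (all 2×3 window sums are zero) and A_{0,0} = A_{0,1} = 0. Then for every row index i with 1 ≤ i ≤ m−1 and every valid column index: (a) A_{i,3j} = A_{i,0} + (−1)^i · A_{0,3j} for every j ≥ 1 with 3j ≤ n−1; (b) A_{i,3j+1} = A_{i,1} + (−1)^i · A_{0,3j+1} for every j ≥ 1 with 3j+1 ≤ n−1; (c) A_{i,3j+2} = −A_{i,0} − A_{i,1} + (−1)^i · A_{0,3j+2} for every j ≥ 0 with 3j+2 ≤ n−1. -/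
/-- If all 2×3 window sums vanish, the sums of three consecutive entries of a row alternate in sign
from one row to the next. -/
theorem row_sum_eq_neg_one_pow_mul {m n : ℕ} {A : Matrix (Fin m) (Fin n) ℤ} (hA : sum23 A = 0)
    (i c : ℕ) (hi : i < m) (hc : c + 2 < n) :
    A ⟨i, hi⟩ ⟨c, by omega⟩ + A ⟨i, hi⟩ ⟨c + 1, by omega⟩ + A ⟨i, hi⟩ ⟨c + 2, hc⟩ =
      (-1 : ℤ) ^ i * (A ⟨0, by omega⟩ ⟨c, by omega⟩ + A ⟨0, by omega⟩ ⟨c + 1, by omega⟩ +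
        A ⟨0, by omega⟩ ⟨c + 2, hc⟩) := by
  induction i with
  | zero => simp
  | succ i ih =>
    have hw := congrFun (congrFun hA ⟨i, by omega⟩) ⟨c, by omega⟩
    simp only [sum23, Matrix.zero_apply] at hw
    rw [pow_succ]
    linear_combination hw - ih (by omega)

/-- If all 2×3 window sums vanish, then `A i c - (-1) ^ i * A 0 c` is 3-periodic in `c`. -/
theorem sub_neg_one_pow_mul_periodic {m n : ℕ} {A : Matrix (Fin m) (Fin n) ℤ} (hA : sum23 A = 0)
    (i r j : ℕ) (hi : i < m) (hc : 3 * j + r < n) :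
    A ⟨i, hi⟩ ⟨3 * j + r, hc⟩ - (-1 : ℤ) ^ i * A ⟨0, by omega⟩ ⟨3 * j + r, hc⟩ =
      A ⟨i, hi⟩ ⟨r, by omega⟩ - (-1 : ℤ) ^ i * A ⟨0, by omega⟩ ⟨r, by omega⟩ := by
  induction j with
  | zero => simp
  | succ j ih =>
    have h₁ := row_sum_eq_neg_one_pow_mul hA i (3 * j + r) hi (by omega)
    have h₂ := row_sum_eq_neg_one_pow_mul hA i (3 * j + r + 1) hi (by omega)
    have hcol : (⟨3 * (j + 1) + r, hc⟩ : Fin n) = ⟨3 * j + r + 1 + 2, by omega⟩ :=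
      Fin.ext (by simp only; ring)
    rw [hcol]
    linear_combination h₂ - h₁ + ih (by omega)

/-- If all 2×3 window sums of `A` vanish and `A 0 0 = A 0 1 = 0`, then the
entries of `A` in the columns `3j`, `3j+1`, `3j+2` are expressed via the first
two columns and the zero row of `A`. -/
theorem entries_of_sum23_eq_zero
    (m n : ℕ) (hm : 2 ≤ m) (hn : 3 ≤ n)
    (A : Matrix (Fin m) (Fin n) ℤ)
    (hA : sum23 A = 0)
    (h00 : A ⟨0, by omega⟩ ⟨0, by omega⟩ = 0)
    (h01 : A ⟨0, by omega⟩ ⟨1, by omega⟩ = 0) :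
    ∀ (i : ℕ) (hi1 : 1 ≤ i) (hi : i ≤ m - 1),
      (∀ (j : ℕ) (hj1 : 1 ≤ j) (hj : 3 * j ≤ n - 1),
        A ⟨i, by omega⟩ ⟨3 * j, by omega⟩
          = A ⟨i, by omega⟩ ⟨0, by omega⟩
            + (-1 : ℤ) ^ i * A ⟨0, by omega⟩ ⟨3 * j, by omega⟩) ∧
      (∀ (j : ℕ) (hj1 : 1 ≤ j) (hj : 3 * j + 1 ≤ n - 1),
        A ⟨i, by omega⟩ ⟨3 * j + 1, by omega⟩
          = A ⟨i, by omega⟩ ⟨1, by omega⟩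
            + (-1 : ℤ) ^ i * A ⟨0, by omega⟩ ⟨3 * j + 1, by omega⟩) ∧
      (∀ (j : ℕ) (hj : 3 * j + 2 ≤ n - 1),
        A ⟨i, by omega⟩ ⟨3 * j + 2, by omega⟩
          = - A ⟨i, by omega⟩ ⟨0, by omega⟩ - A ⟨i, by omega⟩ ⟨1, by omega⟩
            + (-1 : ℤ) ^ i * A ⟨0, by omega⟩ ⟨3 * j + 2, by omega⟩) := by
  intro i _ hi
  refine ⟨fun j _ hj => ?_, fun j _ hj => ?_, fun j hj => ?_⟩
  · have h := sub_neg_one_pow_mul_periodic hA i 0 j (by omega) (by omega)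
    simp only [Nat.add_zero] at h
    linear_combination h - (-1 : ℤ) ^ i * h00
  · have h := sub_neg_one_pow_mul_periodic hA i 1 j (by omega) (by omega)
    linear_combination h - (-1 : ℤ) ^ i * h01
  · have h := sub_neg_one_pow_mul_periodic hA i 2 j (by omega) (by omega)
    have hs := row_sum_eq_neg_one_pow_mul hA i 0 (by omega) (by omega)
    simp only [Nat.zero_add] at hs
    linear_combination h + hs + (-1 : ℤ) ^ i * (h00 + h01)
end
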